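/- arXiv:1809.08097 — 2 statements merged into one kernel-verified Lean document; each statement's English description precedes it below -/
import Mathlib

section
/- Let X be a measurable space, μ_s, μ_t probability measures on X, f_s, f_t : X → ℝ measurable functions with values in [0,1], and h, h' : X → ℝ measurable hypotheses with values in {0,1}. Writing ε_s(h) := ∫ |h − f_s| dμ_s, ε_t(h) := ∫ |h − f_t| dμ_t, and D := {x : h(x) ≠ h'(x)}, one has ε_s(h) ≤ ε_t(h) + ε_s(h') + ε_t(h') + |μ_s(D) − μ_t(D)|. -/
open MeasureTheory

theorem integrable_abs_sub_of_mem_Icc {X : Type*} [MeasurableSpace X] (μ : Measure X)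
    [IsFiniteMeasure μ] {f g : X → ℝ} (hf : Measurable f) (hg : Measurable g)
    (hf01 : ∀ x, f x ∈ Set.Icc (0 : ℝ) 1) (hg01 : ∀ x, g x ∈ Set.Icc (0 : ℝ) 1) :
    Integrable (fun x ↦ |f x - g x|) μ :=
  ((Integrable.of_mem_Icc 0 1 hf.aemeasurable (ae_of_all _ hf01)).sub
    (Integrable.of_mem_Icc 0 1 hg.aemeasurable (ae_of_all _ hg01))).abs

theorem integral_abs_sub_eq_measureReal_ne {X : Type*} [MeasurableSpace X] (μ : Measure X)
    {h h' : X → ℝ} (hh : Measurable h) (hh' : Measurable h')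
    (hhb : ∀ x, h x = 0 ∨ h x = 1) (hh'b : ∀ x, h' x = 0 ∨ h' x = 1) :
    ∫ x, |h x - h' x| ∂μ = μ.real {x | h x ≠ h' x} := by
  have hD : MeasurableSet {x | h x ≠ h' x} := (measurableSet_eq_fun hh hh').compl
  rw [← integral_indicator_one hD]
  congr 1 with x
  rcases hhb x with hx | hx <;> rcases hh'b x with hx' | hx' <;> simp [Set.indicator, hx, hx']

theorem integral_abs_sub_le_add {X : Type*} [MeasurableSpace X] {μ : Measure X} {f g k : X → ℝ}
    (hfg : Integrable (fun x ↦ |f x - g x|) μ) (hgk : Integrable (fun x ↦ |g x - k x|) μ) :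
    ∫ x, |f x - k x| ∂μ ≤ (∫ x, |f x - g x| ∂μ) + ∫ x, |g x - k x| ∂μ := by
  rw [← integral_add hfg hgk]
  exact integral_mono_of_nonneg (ae_of_all _ fun _ ↦ abs_nonneg _) (hfg.add hgk)
    (ae_of_all _ fun _ ↦ abs_sub_le _ _ _)

/-- With `εs(h) = ∫ |h − fs| dμs`, `εt(h) = ∫ |h − ft| dμt` and disagreement set
`D = {x | h x ≠ h' x}`, one has `εs(h) ≤ εt(h) + εs(h') + εt(h') + |μs(D) − μt(D)|`. -/
theorem source_error_le_target_error_add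
    {X : Type*} [MeasurableSpace X]
    (μs μt : Measure X) [IsProbabilityMeasure μs] [IsProbabilityMeasure μt]
    (fs ft : X → ℝ) (hfs : Measurable fs) (hft : Measurable ft)
    (hfs01 : ∀ x, fs x ∈ Set.Icc (0 : ℝ) 1) (hft01 : ∀ x, ft x ∈ Set.Icc (0 : ℝ) 1)
    (h h' : X → ℝ) (hh : Measurable h) (hh' : Measurable h')
    (hhb : ∀ x, h x = 0 ∨ h x = 1) (hh'b : ∀ x, h' x = 0 ∨ h' x = 1) :
    (∫ x, |h x - fs x| ∂μs)
      ≤ (∫ x, |h x - ft x| ∂μt) + (∫ x, |h' x - fs x| ∂μs) + (∫ x, |h' x - ft x| ∂μt)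
        + |(μs {x | h x ≠ h' x}).toReal - (μt {x | h x ≠ h' x}).toReal| := by
  have mem_Icc {u : X → ℝ} (hu : ∀ x, u x = 0 ∨ u x = 1) (x : X) : u x ∈ Set.Icc (0 : ℝ) 1 := by
    rcases hu x with hx | hx <;> simp [hx]
  have hs := integral_abs_sub_le_add
    (integrable_abs_sub_of_mem_Icc μs hh hh' (mem_Icc hhb) (mem_Icc hh'b))
    (integrable_abs_sub_of_mem_Icc μs hh' hfs (mem_Icc hh'b) hfs01)
  have ht := integral_abs_sub_le_add
    (integrable_abs_sub_of_mem_Icc μt hh hft (mem_Icc hhb) hft01)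
    (integrable_abs_sub_of_mem_Icc μt hft hh' hft01 (mem_Icc hh'b))
  simp only [abs_sub_comm (ft _) (h' _)] at ht
  rw [integral_abs_sub_eq_measureReal_ne _ hh hh' hhb hh'b] at hs ht
  have hD := le_abs_self (μs.real {x | h x ≠ h' x} - μt.real {x | h x ≠ h' x})
  simp only [← measureReal_def]
  linarith
end

section
/- (Adaptation bound after adversarial feature matching.) Let X and F be measurable spaces, G : X → F a measurable feature map, and μ_s, μ_t probability measures on X with Map G μ_s = Map G μ_t. Let f_s, f_t : X → ℝ be measurable with values in [0,1], and let H be a nonempty class of hypotheses, each of the form g ∘ G for some measurable g : F → ℝ with values in {0,1}. With ε_s(h) := ∫ |h − f_s| dμ_s, ε_t(h) := ∫ |h − f_t| dμ_t, and λ := inf_{h ∈ H} (ε_s(h) + ε_t(h)), one has for every h ∈ H: ε_s(h) ≤ ε_t(h) + λ. That is, once the induced feature distributions are matched, the H∆H-distance term in the adaptation bound disappears and only the ideal joint error λ separates source and target performance. -/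
open MeasureTheory

theorem integrable_abs_sub_of_mem_Icc_s7 {X : Type*} [MeasurableSpace X]
    (μ : Measure X) [IsFiniteMeasure μ] {u v : X → ℝ} (hu : Measurable u) (hv : Measurable v)
    (hu01 : ∀ x, u x ∈ Set.Icc (0 : ℝ) 1) (hv01 : ∀ x, v x ∈ Set.Icc (0 : ℝ) 1) :
    Integrable (fun x => |u x - v x|) μ := by
  refine Integrable.of_bound (hu.sub hv).abs.aestronglyMeasurable 1 (.of_forall fun x => ?_)
  rw [Real.norm_eq_abs, abs_abs, abs_le]
  constructor <;> linarith [(hu01 x).1, (hu01 x).2, (hv01 x).1, (hv01 x).2]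

theorem integral_abs_sub_le_add_of_mem_Icc {X : Type*} [MeasurableSpace X]
    (μ : Measure X) [IsFiniteMeasure μ] {u v w : X → ℝ}
    (hu : Measurable u) (hv : Measurable v) (hw : Measurable w)
    (hu01 : ∀ x, u x ∈ Set.Icc (0 : ℝ) 1) (hv01 : ∀ x, v x ∈ Set.Icc (0 : ℝ) 1)
    (hw01 : ∀ x, w x ∈ Set.Icc (0 : ℝ) 1) :
    ∫ x, |u x - w x| ∂μ ≤ ∫ x, |u x - v x| ∂μ + ∫ x, |v x - w x| ∂μ := by
  have huv := integrable_abs_sub_of_mem_Icc_s7 μ hu hv hu01 hv01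
  have hvw := integrable_abs_sub_of_mem_Icc_s7 μ hv hw hv01 hw01
  rw [← integral_add huv hvw]
  exact integral_mono (integrable_abs_sub_of_mem_Icc_s7 μ hu hw hu01 hw01) (huv.add hvw)
    fun x => abs_sub_le (u x) (v x) (w x)

/-- Adaptation bound after adversarial feature matching: if the pushforwards of `μs` and
`μt` under the feature map `G` agree and every hypothesis in the nonempty class `H` factors
through `G`, then for every `h ∈ H`, `εs(h) ≤ εt(h) + λ` where
`λ = inf_{h ∈ H} (εs(h) + εt(h))`. -/
theorem adaptation_bound_after_feature_matching
    {X F : Type*} [MeasurableSpace X] [MeasurableSpace F]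
    (G : X → F) (hG : Measurable G)
    (μs μt : Measure X) [IsProbabilityMeasure μs] [IsProbabilityMeasure μt]
    (hmap : Measure.map G μs = Measure.map G μt)
    (fs ft : X → ℝ) (hfs : Measurable fs) (hft : Measurable ft)
    (hfs01 : ∀ x, fs x ∈ Set.Icc (0 : ℝ) 1) (hft01 : ∀ x, ft x ∈ Set.Icc (0 : ℝ) 1)
    (H : Set (X → ℝ)) (hHne : H.Nonempty)
    (hHfac : ∀ h ∈ H, ∃ g : F → ℝ, Measurable g ∧ (∀ y, g y = 0 ∨ g y = 1)
      ∧ h = g ∘ G)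
    (εs εt : (X → ℝ) → ℝ)
    (hεs : ∀ h, εs h = ∫ x, |h x - fs x| ∂μs)
    (hεt : ∀ h, εt h = ∫ x, |h x - ft x| ∂μt)
    (lam : ℝ) (hlam : lam = sInf ((fun h => εs h + εt h) '' H)) :
    ∀ h ∈ H, εs h ≤ εt h + lam := by
  intro h hh
  rw [← sub_le_iff_le_add', hlam]
  refine le_csInf (hHne.image _) ?_
  rintro _ ⟨h', hh', rfl⟩
  obtain ⟨g, hg, hg01, rfl⟩ := hHfac h hh
  obtain ⟨g', hg', hg'01, rfl⟩ := hHfac h' hh'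
  have mem_Icc {k : F → ℝ} (hk : ∀ y, k y = 0 ∨ k y = 1) (x : X) :
      (k ∘ G) x ∈ Set.Icc (0 : ℝ) 1 := by
    rcases hk (G x) with h0 | h0 <;> simp [h0]
  have hdisagree : ∫ x, |(g ∘ G) x - (g' ∘ G) x| ∂μs = ∫ x, |(g ∘ G) x - (g' ∘ G) x| ∂μt := by
    have hm : StronglyMeasurable fun y => |g y - g' y| := (hg.sub hg').abs.stronglyMeasurable
    have hs := integral_map_of_stronglyMeasurable (μ := μs) hG hm
    have ht := integral_map_of_stronglyMeasurable (μ := μt) hG hm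
    rw [hmap] at hs
    exact hs.symm.trans ht
  have hsource := integral_abs_sub_le_add_of_mem_Icc μs (hg.comp hG) (hg'.comp hG) hfs
    (mem_Icc hg01) (mem_Icc hg'01) hfs01
  have htarget := integral_abs_sub_le_add_of_mem_Icc μt (hg.comp hG) hft (hg'.comp hG)
    (mem_Icc hg01) hft01 (mem_Icc hg'01)
  simp only [abs_sub_comm (ft _)] at htarget
  simp only [hεs, hεt]
  linarith
end
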